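/- arXiv:1508.01995 — 2 statements merged into one kernel-verified Lean document; each statement's English description precedes it below -/
import Mathlib

section
/- Let m ≥ 1 and let B be a nondegenerate symmetric bilinear form on a complex vector space V of dimension 2m. The set of m-dimensional totally isotropic subspaces of V for B is nonempty, the relation U ~ U' defined by 'm − dim(U ∩ U') is even' is an equivalence relation on this set, and this relation has exactly two equivalence classes. -/
/-- A subspace `U` is totally isotropic for a bilinear form `B`. -/
def IsTotIso {M : Type*} [AddCommGroup M] [Module ℂ M]
    (B : LinearMap.BilinForm ℂ M) (U : Submodule ℂ M) : Prop :=
  ∀ x ∈ U, ∀ y ∈ U, B x y = 0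

open Module

/-! ### Alternating forms have even rank -/

section Alternating

variable {K P : Type*} [Field K] [CharZero K] [AddCommGroup P] [Module K P]
  [FiniteDimensional K P]

theorem LinearMap.BilinForm.IsAlt.even_finrank_of_ker_eq_bot {ω : LinearMap.BilinForm K P}
    (hω : ω.IsAlt) (hker : LinearMap.ker ω = ⊥) : Even (finrank K P) := by
  have hnd : ω.Nondegenerate :=
    (LinearMap.IsRefl.nondegenerate_iff_separatingLeft hω.isRefl).2
      (LinearMap.separatingLeft_iff_ker_eq_bot.2 hker)
  have hdet := (LinearMap.BilinForm.nondegenerate_iff_det_ne_zero (finBasis K P)).1 hnd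
  set A := LinearMap.BilinForm.toMatrix (finBasis K P) ω
  have hA : A.transpose = -A := by
    ext i j
    simp [A, LinearMap.BilinForm.toMatrix_apply, hω.neg_eq]
  by_contra hodd
  have h : A.det = -A.det := by
    conv_lhs => rw [← A.det_transpose, hA, Matrix.det_neg, Fintype.card_fin,
      (Nat.not_even_iff_odd.1 hodd).neg_one_pow, neg_one_mul]
  exact hdet (self_eq_neg.1 h)

theorem LinearMap.BilinForm.IsAlt.even_finrank_range {ω : LinearMap.BilinForm K P}
    (hω : ω.IsAlt) : Even (finrank K (LinearMap.range ω)) := by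
  obtain ⟨W, hW⟩ := (LinearMap.ker ω).exists_isCompl
  have hdim : finrank K (LinearMap.range ω) = finrank K W := by
    have := Submodule.finrank_add_eq_of_isCompl hW
    have := LinearMap.finrank_range_add_finrank_ker ω
    omega
  rw [hdim]
  refine LinearMap.BilinForm.IsAlt.even_finrank_of_ker_eq_bot (ω := ω.restrict W)
    (fun x => hω x) ?_
  refine LinearMap.ker_eq_bot'.2 fun w hw => ?_
  have hwker : (w : P) ∈ LinearMap.ker ω := by
    refine LinearMap.mem_ker.2 (LinearMap.ext fun x => ?_)
    obtain ⟨k, hk, v, hv, rfl⟩ := Submodule.mem_sup.1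
      (hW.sup_eq_top ▸ Submodule.mem_top : x ∈ LinearMap.ker ω ⊔ W)
    have hv0 : ω w v = 0 := LinearMap.congr_fun hw ⟨v, hv⟩
    have hk0 : ω w k = 0 := hω.isRefl _ _ (by rw [LinearMap.mem_ker.1 hk]; rfl)
    simp [hv0, hk0]
  exact Subtype.ext (Submodule.disjoint_def.1 hW.disjoint _ hwker w.2)

end Alternating

/-! ### Dimension of subspaces of a product -/

section Dimension

variable {K M N : Type*} [Field K] [AddCommGroup M] [Module K M] [AddCommGroup N] [Module K N]

theorem Submodule.finrank_map_add_finrank_inf_ker [FiniteDimensional K M] (f : M →ₗ[K] N)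
    (P : Submodule K M) :
    finrank K (P.map f) + finrank K ↥(P ⊓ LinearMap.ker f) = finrank K P := by
  have h := LinearMap.finrank_range_add_finrank_ker (f.domRestrict P)
  rw [LinearMap.range_domRestrict] at h
  rw [← h, ← Submodule.finrank_map_subtype_eq P (LinearMap.ker (f.domRestrict P)),
    LinearMap.ker_domRestrict, Submodule.map_comap_subtype]

theorem Submodule.finrank_map_of_injective {f : M →ₗ[K] N} (hf : Function.Injective f)
    (P : Submodule K M) : finrank K (P.map f) = finrank K P :=
  (Submodule.equivMapOfInjective f hf P).finrank_eq.symm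

end Dimension

/-! ### Maximal isotropic subspaces -/

section Isotropic

variable {V : Type*} [AddCommGroup V] [Module ℂ V] {B : LinearMap.BilinForm ℂ V}

theorem IsTotIso.le_orthogonal {U : Submodule ℂ V} (hU : IsTotIso B U) : U ≤ B.orthogonal U :=
  fun y hy x hx => hU x hx y hy

theorem IsTotIso.sup_span_singleton (hsymm : ∀ x y, B x y = B y x) {U : Submodule ℂ V}
    (hU : IsTotIso B U) {x : V} (hx : x ∈ B.orthogonal U) (hxx : B x x = 0) :
    IsTotIso B (U ⊔ Submodule.span ℂ {x}) := by
  intro a ha b hb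
  obtain ⟨u, hu, p, hp, rfl⟩ := Submodule.mem_sup.1 ha
  obtain ⟨v, hv, q, hq, rfl⟩ := Submodule.mem_sup.1 hb
  obtain ⟨s, rfl⟩ := Submodule.mem_span_singleton.1 hp
  obtain ⟨t, rfl⟩ := Submodule.mem_span_singleton.1 hq
  have hux : B u x = 0 := hx u hu
  have hxv : B x v = 0 := (hsymm x v).trans (hx v hv)
  simp [hU u hu v hv, hux, hxv, hxx]

variable [FiniteDimensional ℂ V]

theorem finrank_add_finrank_orthogonal_of_ker_eq_bot (hsymm : ∀ x y, B x y = B y x)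
    (hnd : LinearMap.ker B = ⊥) (W : Submodule ℂ V) :
    finrank ℂ W + finrank ℂ (B.orthogonal W) = finrank ℂ V := by
  have hrefl : B.IsRefl := fun x y h => (hsymm y x).trans h
  rw [LinearMap.BilinForm.finrank_add_finrank_orthogonal hrefl,
    LinearMap.BilinForm.orthogonal_top_eq_ker hrefl, hnd]
  simp

theorem IsTotIso.orthogonal_eq (hsymm : ∀ x y, B x y = B y x) (hnd : LinearMap.ker B = ⊥)
    {U : Submodule ℂ V} (hU : IsTotIso B U) (hdim : finrank ℂ V = 2 * finrank ℂ U) :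
    B.orthogonal U = U := by
  have := finrank_add_finrank_orthogonal_of_ker_eq_bot hsymm hnd U
  exact (Submodule.eq_of_le_of_finrank_eq hU.le_orthogonal (by omega)).symm

/-- The quadratic form of `B` has a zero in `U^⊥ \ U` when `dim U^⊥ ≥ dim U + 2`. -/
theorem exists_isotropic_mem_orthogonal_notMem (hsymm : ∀ x y, B x y = B y x)
    (hnd : LinearMap.ker B = ⊥) (U : Submodule ℂ V)
    (hdim : 2 * finrank ℂ U + 2 ≤ finrank ℂ V) :
    ∃ x ∈ B.orthogonal U, x ∉ U ∧ B x x = 0 := by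
  have hadd := finrank_add_finrank_orthogonal_of_ker_eq_bot hsymm hnd U
  have key (W : Submodule ℂ V) (hW : finrank ℂ W ≤ finrank ℂ U + 1) :
      ∃ x ∈ B.orthogonal U, x ∉ W := by
    refine SetLike.not_le_iff_exists.1 fun hle => ?_
    have := Submodule.finrank_mono hle
    omega
  obtain ⟨x, hx, hxU⟩ := key U (by omega)
  by_cases hxx : B x x = 0
  · exact ⟨x, hx, hxU, hxx⟩
  obtain ⟨y, hy, hyU⟩ := key (U ⊔ Submodule.span ℂ {x})
    (Submodule.finrank_sup_span_singleton hxU).le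
  obtain ⟨t, ht⟩ := exists_quadratic_eq_zero (b := 2 * B x y) (c := B y y) hxx
    (IsAlgClosed.exists_eq_mul_self _)
  refine ⟨y + t • x, add_mem hy (Submodule.smul_mem _ _ hx), fun hmem => hyU ?_, ?_⟩
  · exact Submodule.mem_sup.2 ⟨_, hmem, -(t • x),
      neg_mem (Submodule.smul_mem _ _ (Submodule.mem_span_singleton_self x)), by abel⟩
  · simp only [map_add, map_smul, LinearMap.add_apply, LinearMap.smul_apply, smul_eq_mul,
      hsymm y x]
    linear_combination ht

theorem exists_isTotIso_finrank_eq (hsymm : ∀ x y, B x y = B y x) (hnd : LinearMap.ker B = ⊥)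
    (k : ℕ) (hk : 2 * k ≤ finrank ℂ V) :
    ∃ U : Submodule ℂ V, finrank ℂ U = k ∧ IsTotIso B U := by
  induction k with
  | zero =>
    refine ⟨⊥, finrank_bot ℂ V, fun x hx y _ => ?_⟩
    simp [(Submodule.mem_bot ℂ).1 hx]
  | succ k ih =>
    obtain ⟨U, hUk, hU⟩ := ih (by omega)
    obtain ⟨x, hx, hxU, hxx⟩ :=
      exists_isotropic_mem_orthogonal_notMem hsymm hnd U (by omega)
    exact ⟨_, by rw [Submodule.finrank_sup_span_singleton hxU, hUk],
      hU.sup_span_singleton hsymm hx hxx⟩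

theorem exists_isTotIso_pair (hsymm : ∀ x y, B x y = B y x) (hnd : LinearMap.ker B = ⊥)
    {k : ℕ} (hk : finrank ℂ V = 2 * (k + 1)) :
    ∃ U₁ U₂ : Submodule ℂ V, (finrank ℂ U₁ = k + 1 ∧ IsTotIso B U₁) ∧
      (finrank ℂ U₂ = k + 1 ∧ IsTotIso B U₂) ∧ finrank ℂ ↥(U₁ ⊓ U₂) = k := by
  obtain ⟨H, hHk, hH⟩ := exists_isTotIso_finrank_eq hsymm hnd k (by omega)
  obtain ⟨u, hu, huH, huu⟩ :=
      exists_isotropic_mem_orthogonal_notMem hsymm hnd H (by omega)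
  set U₁ := H ⊔ Submodule.span ℂ {u} with hU₁_def
  have hU₁ : IsTotIso B U₁ := hH.sup_span_singleton hsymm hu huu
  have hU₁k : finrank ℂ U₁ = k + 1 := by
    rw [hU₁_def, Submodule.finrank_sup_span_singleton huH, hHk]
  have hadd := finrank_add_finrank_orthogonal_of_ker_eq_bot hsymm hnd H
  obtain ⟨y, hy, hyU₁⟩ : ∃ y ∈ B.orthogonal H, y ∉ U₁ := by
    refine SetLike.not_le_iff_exists.1 fun hle => ?_
    have := Submodule.finrank_mono hle
    omega
  have huy : B u y ≠ 0 := by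
    refine fun h => hyU₁ ?_
    rw [← hU₁.orthogonal_eq hsymm hnd (by omega)]
    intro a ha
    obtain ⟨v, hv, p, hp, rfl⟩ := Submodule.mem_sup.1 ha
    obtain ⟨s, rfl⟩ := Submodule.mem_span_singleton.1 hp
    have hvy : B v y = 0 := hy v hv
    simp [hvy, h]
  have huU₁ : u ∈ U₁ := Submodule.mem_sup_right (Submodule.mem_span_singleton_self u)
  obtain ⟨t, ht⟩ : ∃ t : ℂ, B y y + 2 * t * B u y = 0 :=
    ⟨-(B y y) / (2 * B u y), by field_simp; ring⟩
  set x := y + t • u with hx_def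
  have hxU₁ : x ∉ U₁ := fun h => hyU₁ <| by
    simpa [hx_def] using sub_mem h (U₁.smul_mem t huU₁)
  have hx : x ∈ B.orthogonal H := add_mem hy (Submodule.smul_mem _ _ hu)
  have hxx : B x x = 0 := by
    simp only [hx_def, map_add, map_smul, LinearMap.add_apply, LinearMap.smul_apply, smul_eq_mul,
      hsymm y u, huu]
    linear_combination ht
  have hHU₁ : H ≤ U₁ := le_sup_left
  have hU₂k : finrank ℂ ↥(H ⊔ Submodule.span ℂ {x}) = k + 1 := by
    rw [Submodule.finrank_sup_span_singleton fun h => hxU₁ (hHU₁ h), hHk]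
  refine ⟨U₁, H ⊔ Submodule.span ℂ {x}, ⟨hU₁k, hU₁⟩,
    ⟨hU₂k, hH.sup_span_singleton hsymm hx hxx⟩, le_antisymm ?_ ?_⟩
  · refine Nat.le_of_lt_succ ?_
    rw [Nat.succ_eq_add_one, ← hU₂k]
    refine Submodule.finrank_lt_finrank_of_lt (lt_of_le_of_ne inf_le_right fun h => hxU₁ ?_)
    exact inf_eq_right.1 h (Submodule.mem_sup_right (Submodule.mem_span_singleton_self x))
  · rw [← hHk]
    exact Submodule.finrank_mono (le_inf hHU₁ le_sup_left)

/-- For three maximal isotropic subspaces, the rank of the alternating form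
`((u, u'), (v, v')) ↦ B u v'` on `{(u, u') ∈ U₁ × U₂ | u + u' ∈ U₃}` is
`m - dim (U₁ ∩ U₂) - dim (U₁ ∩ U₃) - dim (U₂ ∩ U₃) + 2 dim (U₁ ∩ U₂ ∩ U₃)`. -/
theorem even_add_finrank_inf_of_isTotIso (hsymm : ∀ x y, B x y = B y x)
    (hnd : LinearMap.ker B = ⊥) {m : ℕ} (hdim : finrank ℂ V = 2 * m) {U₁ U₂ U₃ : Submodule ℂ V}
    (h₁ : finrank ℂ U₁ = m ∧ IsTotIso B U₁) (h₂ : finrank ℂ U₂ = m ∧ IsTotIso B U₂)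
    (h₃ : finrank ℂ U₃ = m ∧ IsTotIso B U₃) :
    Even (m + finrank ℂ ↥(U₁ ⊓ U₂) + finrank ℂ ↥(U₁ ⊓ U₃) + finrank ℂ ↥(U₂ ⊓ U₃)) := by
  have hrefl : B.IsRefl := fun x y h => (hsymm y x).trans h
  have hperp {U : Submodule ℂ V} (hU : finrank ℂ U = m ∧ IsTotIso B U) : B.orthogonal U = U :=
    hU.2.orthogonal_eq hsymm hnd (by omega)
  have hnondeg : B.Nondegenerate :=
    (LinearMap.IsRefl.nondegenerate_iff_separatingLeft hrefl).2
      (LinearMap.separatingLeft_iff_ker_eq_bot.2 hnd)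
  let σ : V × V →ₗ[ℂ] V := LinearMap.fst ℂ V V + LinearMap.snd ℂ V V
  let P : Submodule ℂ (V × V) := U₁.prod U₂ ⊓ U₃.comap σ
  have hP {p : V × V} : p ∈ P ↔ (p.1 ∈ U₁ ∧ p.2 ∈ U₂) ∧ p.1 + p.2 ∈ U₃ := Iff.rfl
  let ω : LinearMap.BilinForm ℂ P :=
    B.compl₁₂ (LinearMap.fst ℂ V V ∘ₗ P.subtype) (LinearMap.snd ℂ V V ∘ₗ P.subtype)
  have hω (p q : P) : ω p q = B p.1.1 q.1.2 := rfl
  have halt : ω.IsAlt := by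
    rintro ⟨⟨u, u'⟩, hp⟩
    obtain ⟨⟨hu, hu'⟩, hs⟩ := hP.1 hp
    have h := h₃.2 _ hs _ hs
    simp only [map_add, LinearMap.add_apply, h₁.2 u hu u hu, h₂.2 u' hu' u' hu', hsymm u' u] at h
    rw [hω]
    linear_combination h / 2
  let S : Submodule ℂ V := U₃ ⊓ (U₁ ⊔ U₂)
  -- the orthogonal complement of `U₃ ∩ (U₁ + U₂)` is `U₃ + U₁ ∩ U₂`
  have hS : B.orthogonal (U₃ ⊔ U₁ ⊓ U₂) = S := by
    refine le_antisymm (le_inf ?_ ?_) ?_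
    · exact (LinearMap.BilinForm.orthogonal_le le_sup_left).trans (hperp h₃).le
    · rw [← LinearMap.BilinForm.orthogonal_orthogonal hnondeg hrefl (U₁ ⊔ U₂)]
      exact LinearMap.BilinForm.orthogonal_le <| le_sup_of_le_right <| le_inf
        ((LinearMap.BilinForm.orthogonal_le le_sup_left).trans (hperp h₁).le)
        ((LinearMap.BilinForm.orthogonal_le le_sup_right).trans (hperp h₂).le)
    · rintro x ⟨hx₃, hx⟩ a ha
      obtain ⟨w, hw, z, hz, rfl⟩ := Submodule.mem_sup.1 ha
      obtain ⟨u, hu, u', hu', rfl⟩ := Submodule.mem_sup.1 hx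
      have hwx := h₃.2 w hw _ hx₃
      rw [map_add] at hwx
      simp [hwx, h₁.2 z hz.1 u hu, h₂.2 z hz.2 u' hu']
  have hSperp : B.orthogonal S = U₃ ⊔ U₁ ⊓ U₂ := by
    rw [← hS, LinearMap.BilinForm.orthogonal_orthogonal hnondeg hrefl]
  have hmapP : P.map σ = S := by
    ext x
    constructor
    · rintro ⟨p, hp, rfl⟩
      obtain ⟨⟨hu, hu'⟩, hs⟩ := hP.1 hp
      exact ⟨hs, Submodule.add_mem_sup hu hu'⟩
    · rintro ⟨hx, hx'⟩
      obtain ⟨u, hu, u', hu', rfl⟩ := Submodule.mem_sup.1 hx'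
      exact ⟨(u, u'), hP.2 ⟨⟨hu, hu'⟩, hx⟩, rfl⟩
  have hkerP : P ⊓ LinearMap.ker σ =
      (U₁ ⊓ U₂).map (LinearMap.prod LinearMap.id (-LinearMap.id)) := by
    ext ⟨u, u'⟩
    constructor
    · rintro ⟨hp, hk⟩
      obtain ⟨⟨hu, hu'⟩, -⟩ := hP.1 hp
      have hk : u' = -u := (neg_eq_of_add_eq_zero_right hk).symm
      subst hk
      exact ⟨u, ⟨hu, neg_mem_iff.1 hu'⟩, rfl⟩
    · rintro ⟨v, ⟨hv, hv'⟩, h⟩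
      obtain ⟨rfl, rfl⟩ := Prod.mk.inj h
      exact ⟨hP.2 ⟨⟨hv, neg_mem hv'⟩, by simp⟩, by simp [σ]⟩
  let T : Submodule ℂ V := U₁ ⊓ U₂ ⊔ U₁ ⊓ U₃
  let R : Submodule ℂ (V × V) := P ⊓ T.comap (LinearMap.fst ℂ V V)
  have hker : (LinearMap.ker ω).map P.subtype = R := by
    ext ⟨u, u'⟩
    constructor
    · rintro ⟨⟨p, hp⟩, hk, rfl⟩
      refine ⟨hp, ?_⟩
      obtain ⟨⟨hu, hu'⟩, hs⟩ := hP.1 hp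
      have hmem : u ∈ B.orthogonal S := by
        rw [← hmapP]
        rintro _ ⟨q, hq, rfl⟩
        obtain ⟨⟨hv, hv'⟩, -⟩ := hP.1 hq
        have h : B u q.2 = 0 := LinearMap.congr_fun (LinearMap.mem_ker.1 hk) ⟨q, hq⟩
        refine hrefl _ _ ?_
        simp [σ, h₁.2 u hu _ hv, h]
      rw [hSperp] at hmem
      obtain ⟨w, hw, z, hz, rfl⟩ := Submodule.mem_sup.1 hmem
      have hw₁ : w ∈ U₁ := by simpa using sub_mem hu hz.1
      exact Submodule.mem_sup.2 ⟨z, hz, w, ⟨hw₁, hw⟩, add_comm z w⟩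
    · rintro ⟨hp, hT⟩
      refine ⟨⟨(u, u'), hp⟩, LinearMap.mem_ker.2 (LinearMap.ext ?_), rfl⟩
      rintro ⟨⟨v, v'⟩, hq⟩
      obtain ⟨⟨hv, hv'⟩, hs⟩ := hP.1 hq
      obtain ⟨z, hz, w, hw, h⟩ := Submodule.mem_sup.1 hT
      have h : u = z + w := h.symm
      have h' := h₃.2 w hw.2 _ hs
      simp only [map_add, h₁.2 w hw.1 v hv, zero_add] at h'
      change B u v' = 0
      simp [h, h₂.2 z hz.2 v' hv', h']
  have hmapR : R.map (LinearMap.fst ℂ V V) = T := by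
    ext x
    constructor
    · rintro ⟨p, hp, rfl⟩
      exact hp.2
    · intro hx
      obtain ⟨z, hz, w, hw, rfl⟩ := Submodule.mem_sup.1 hx
      exact ⟨(z + w, -z), ⟨hP.2 ⟨⟨add_mem hz.1 hw.1, neg_mem hz.2⟩, by simpa using hw.2⟩, hx⟩,
        rfl⟩
  have hkerR : R ⊓ LinearMap.ker (LinearMap.fst ℂ V V) =
      (U₂ ⊓ U₃).map (LinearMap.inr ℂ V V) := by
    ext ⟨u, u'⟩
    constructor
    · rintro ⟨⟨hp, -⟩, hk⟩
      obtain ⟨⟨-, hu'⟩, hs⟩ := hP.1 hp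
      have hk : u = 0 := hk
      subst hk
      exact ⟨u', ⟨hu', by simpa using hs⟩, rfl⟩
    · rintro ⟨v, ⟨hv, hv'⟩, h⟩
      obtain ⟨rfl, rfl⟩ := Prod.mk.inj h
      exact ⟨⟨hP.2 ⟨⟨zero_mem _, hv⟩, by simpa using hv'⟩, T.zero_mem⟩, rfl⟩
  have dP := Submodule.finrank_map_add_finrank_inf_ker σ P
  rw [hmapP, hkerP, Submodule.finrank_map_of_injective
    fun x y h => (Prod.mk.inj h).1] at dP
  have dR := Submodule.finrank_map_add_finrank_inf_ker (LinearMap.fst ℂ V V) R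
  rw [hmapR, hkerR, Submodule.finrank_map_of_injective LinearMap.inr_injective] at dR
  have dω := LinearMap.finrank_range_add_finrank_ker ω
  rw [← Submodule.finrank_map_subtype_eq, hker] at dω
  have dS := finrank_add_finrank_orthogonal_of_ker_eq_bot hsymm hnd (U₃ ⊔ U₁ ⊓ U₂)
  rw [hS] at dS
  have dsup := Submodule.finrank_sup_add_finrank_inf_eq U₃ (U₁ ⊓ U₂)
  have dT := Submodule.finrank_sup_add_finrank_inf_eq (U₁ ⊓ U₂) (U₁ ⊓ U₃)
  have hinf : U₁ ⊓ U₂ ⊓ (U₁ ⊓ U₃) = U₃ ⊓ (U₁ ⊓ U₂) := by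
    rw [inf_inf_inf_comm, inf_idem, inf_comm U₃, inf_assoc]
  rw [hinf] at dT
  obtain ⟨r, hr⟩ := halt.even_finrank_range
  have hm₃ := h₃.1
  rw [Nat.even_iff]
  simp only [T] at dR
  omega

end Isotropic

/-- For a nondegenerate symmetric bilinear form `B` on a complex vector space of
dimension `2m` (`m ≥ 1`), the set of `m`-dimensional totally isotropic subspaces is nonempty,
the relation `U ~ U'` defined by "`m - dim (U ⊓ U')` is even" is an equivalence relation on
this set, and it has exactly two equivalence classes. -/
theorem stmt3 {V : Type*} [AddCommGroup V] [Module ℂ V] [FiniteDimensional ℂ V]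
    (m : ℕ) (hm : 1 ≤ m) (hdim : Module.finrank ℂ V = 2 * m)
    (B : LinearMap.BilinForm ℂ V) (hsymm : ∀ x y, B x y = B y x)
    (hnd : LinearMap.ker B = ⊥) :
    (∃ U : Submodule ℂ V, Module.finrank ℂ U = m ∧ IsTotIso B U) ∧
    Equivalence (fun U U' : {U : Submodule ℂ V // Module.finrank ℂ U = m ∧ IsTotIso B U} =>
      Even (m - Module.finrank ℂ ↥(U.1 ⊓ U'.1))) ∧
    (∃ U₁ U₂ : {U : Submodule ℂ V // Module.finrank ℂ U = m ∧ IsTotIso B U},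
      ¬ Even (m - Module.finrank ℂ ↥(U₁.1 ⊓ U₂.1)) ∧
      ∀ U : {U : Submodule ℂ V // Module.finrank ℂ U = m ∧ IsTotIso B U},
        Even (m - Module.finrank ℂ ↥(U.1 ⊓ U₁.1)) ∨
        Even (m - Module.finrank ℂ ↥(U.1 ⊓ U₂.1))) := by
  have parity (U U' U'' : {U : Submodule ℂ V // finrank ℂ U = m ∧ IsTotIso B U}) :
      Even (m + finrank ℂ ↥(U.1 ⊓ U'.1) + finrank ℂ ↥(U.1 ⊓ U''.1) + finrank ℂ ↥(U'.1 ⊓ U''.1)) :=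
    even_add_finrank_inf_of_isTotIso hsymm hnd hdim U.2 U'.2 U''.2
  have hle (U U' : {U : Submodule ℂ V // finrank ℂ U = m ∧ IsTotIso B U}) :
      finrank ℂ ↥(U.1 ⊓ U'.1) ≤ m :=
    (Submodule.finrank_mono inf_le_left).trans U.2.1.le
  refine ⟨exists_isTotIso_finrank_eq hsymm hnd m hdim.ge, ⟨fun U => ?_, fun {U U'} h => ?_,
    fun {U U' U''} h h' => ?_⟩, ?_⟩
  · rw [inf_idem, U.2.1, Nat.sub_self]
    exact Even.zero
  · rwa [inf_comm]
  · have h₁ := parity U U' U''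
    have h₂ := hle U U'
    have h₃ := hle U' U''
    have h₄ := hle U U''
    rw [Nat.even_iff] at h h' h₁ ⊢
    omega
  · obtain ⟨k, rfl⟩ := Nat.exists_eq_add_of_le' hm
    obtain ⟨U₁, U₂, h₁, h₂, hk⟩ := exists_isTotIso_pair hsymm hnd hdim
    refine ⟨⟨U₁, h₁⟩, ⟨U₂, h₂⟩, by simp [hk], fun U => ?_⟩
    have hpar := parity U ⟨U₁, h₁⟩ ⟨U₂, h₂⟩
    have hle₁ := hle U ⟨U₁, h₁⟩
    have hle₂ := hle U ⟨U₂, h₂⟩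
    simp only [hk] at hpar hle₁ hle₂ ⊢
    rw [Nat.even_iff] at hpar
    rw [Nat.even_iff, Nat.even_iff]
    omega
end

section
/- Let n ≥ 3 and let W be a complex vector space of dimension n+1. For every 3-dimensional subspace U ⊆ Λ²W, the following are equivalent: (a) the linear span in Λ⁴W of the set {ω ∧ ω' : ω, ω' ∈ U} has dimension at most 1; (b) there exists a 4-dimensional subspace W₄ ⊆ W with U ⊆ Λ²W₄. -/
/-- The image of `Λ²W'` in the exterior algebra of `W`, for a subspace `W' ⊆ W`:
the span of products `a ∧ b` with `a, b ∈ W'`. -/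
noncomputable def wedgeSq {W : Type*} [AddCommGroup W] [Module ℂ W]
    (W' : Submodule ℂ W) : Submodule ℂ (ExteriorAlgebra ℂ W) :=
  Submodule.span ℂ
    {z | ∃ a ∈ W', ∃ b ∈ W', z = ExteriorAlgebra.ι ℂ a * ExteriorAlgebra.ι ℂ b}

open ExteriorAlgebra

section

variable {W : Type*} [AddCommGroup W] [Module ℂ W]

lemma exists_dual_eq_one_of_notMem {p : Submodule ℂ W} {x : W} (hx : x ∉ p) :
    ∃ f : Module.Dual ℂ W, f x = 1 ∧ ∀ y ∈ p, f y = 0 := by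
  obtain ⟨f, hfx, hfp⟩ := p.exists_dual_map_eq_bot_of_notMem hx inferInstance
  refine ⟨(f x)⁻¹ • f, by simp [hfx], fun y hy => ?_⟩
  have : f y ∈ p.map f := Submodule.mem_map_of_mem hy
  rw [hfp, Submodule.mem_bot] at this
  simp [this]

lemma mem_of_forall_dual_eq_zero {p : Submodule ℂ W} {x : W}
    (h : ∀ f : Module.Dual ℂ W, (∀ y ∈ p, f y = 0) → f x = 0) : x ∈ p := by
  by_contra hx
  obtain ⟨f, hfx, hfp⟩ := exists_dual_eq_one_of_notMem hx
  simp [h f hfp] at hfx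

namespace ExteriorAlgebra

/-- Contraction of the exterior algebra by a linear form. -/
noncomputable def contract (f : Module.Dual ℂ W) :
    ExteriorAlgebra ℂ W →ₗ[ℂ] ExteriorAlgebra ℂ W :=
  CliffordAlgebra.contractLeft f

lemma contract_ι_mul (f : Module.Dual ℂ W) (a : W) (z : ExteriorAlgebra ℂ W) :
    contract f (ι ℂ a * z) = f a • z - ι ℂ a * contract f z :=
  CliffordAlgebra.contractLeft_ι_mul f a z

lemma contract_ι (f : Module.Dual ℂ W) (a : W) :
    contract f (ι ℂ a) = algebraMap ℂ _ (f a) :=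
  CliffordAlgebra.contractLeft_ι _ f a

lemma contract_ι_mul_ι (f : Module.Dual ℂ W) (a b : W) :
    contract f (ι ℂ a * ι ℂ b) = ι ℂ (f a • b - f b • a) := by
  rw [contract_ι_mul, contract_ι, ← Algebra.commutes, ← Algebra.smul_def, map_sub, map_smul,
    map_smul]

lemma ι_mul_ι_swap (a b : W) : ι ℂ a * ι ℂ b = -(ι ℂ b * ι ℂ a) :=
  eq_neg_of_add_eq_zero_left (ι_add_mul_swap a b)

lemma ι_mul_ι_left (a : W) (z : ExteriorAlgebra ℂ W) : ι ℂ a * (ι ℂ a * z) = 0 := by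
  rw [← mul_assoc, ι_sq_zero, zero_mul]

lemma contract_ιMulti_eq_zero (f : Module.Dual ℂ W) {n : ℕ} (v : Fin n → W)
    (hf : ∀ i, f (v i) = 0) : contract f (ιMulti ℂ n v) = 0 := by
  induction n with
  | zero => simp [ιMulti_zero_apply, contract]
  | succ n ih =>
    rw [ιMulti_succ_apply, contract_ι_mul, hf, ih (Matrix.vecTail v) fun i => hf i.succ]
    simp

lemma ιMulti_ne_zero {n : ℕ} {v : Fin n → W} (hv : LinearIndependent ℂ v) :
    ιMulti ℂ n v ≠ 0 := by
  induction n with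
  | zero => simp [ιMulti_zero_apply]
  | succ n ih =>
    rw [linearIndependent_finSucc] at hv
    obtain ⟨f, hf, hfv⟩ := exists_dual_eq_one_of_notMem hv.2
    intro h
    refine ih hv.1 ?_
    have := congrArg (contract f) h
    rw [ιMulti_succ_apply, contract_ι_mul, hf] at this
    have h0 := contract_ιMulti_eq_zero f (Fin.tail v)
      fun i => hfv _ (Submodule.subset_span ⟨i, rfl⟩)
    simp only [Matrix.vecTail, Fin.tail_def, Function.comp_def] at *
    simpa [h0] using this

lemma ι_mul_mem_wedgeSq {p : Submodule ℂ W} {a b : W} (ha : a ∈ p) (hb : b ∈ p) :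
    ι ℂ a * ι ℂ b ∈ wedgeSq p :=
  Submodule.subset_span ⟨a, ha, b, hb, rfl⟩

lemma wedgeSq_mono {p q : Submodule ℂ W} (h : p ≤ q) : wedgeSq p ≤ wedgeSq q :=
  Submodule.span_mono fun _ ⟨a, ha, b, hb, hz⟩ => ⟨a, h ha, b, h hb, hz⟩

lemma exists_contract_eq_ι {ω : ExteriorAlgebra ℂ W} (hω : ω ∈ wedgeSq (⊤ : Submodule ℂ W))
    (f : Module.Dual ℂ W) : ∃ x, contract f ω = ι ℂ x := by
  induction hω using Submodule.span_induction with
  | mem z hz =>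
    obtain ⟨a, -, b, -, rfl⟩ := hz
    exact ⟨_, contract_ι_mul_ι f a b⟩
  | zero => exact ⟨0, by simp⟩
  | add x y _ _ hx hy =>
    obtain ⟨a, ha⟩ := hx
    obtain ⟨b, hb⟩ := hy
    exact ⟨a + b, by simp [ha, hb]⟩
  | smul c x _ hx =>
    obtain ⟨a, ha⟩ := hx
    exact ⟨c • a, by simp [ha]⟩

lemma bivector_mul_ι {ω : ExteriorAlgebra ℂ W} (hω : ω ∈ wedgeSq (⊤ : Submodule ℂ W)) (v : W) :
    ω * ι ℂ v = ι ℂ v * ω := by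
  induction hω using Submodule.span_induction with
  | mem z hz =>
    obtain ⟨a, -, b, -, rfl⟩ := hz
    rw [mul_assoc, ι_mul_ι_swap b v, mul_neg, ← mul_assoc, ι_mul_ι_swap a v, neg_mul, neg_neg,
      mul_assoc]
  | zero => simp
  | add x y _ _ hx hy => rw [add_mul, mul_add, hx, hy]
  | smul c x _ hx => rw [smul_mul_assoc, mul_smul_comm, hx]

lemma bivector_mul_comm {ω ω' : ExteriorAlgebra ℂ W} (hω : ω ∈ wedgeSq (⊤ : Submodule ℂ W))
    (hω' : ω' ∈ wedgeSq (⊤ : Submodule ℂ W)) : ω * ω' = ω' * ω := by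
  induction hω' using Submodule.span_induction with
  | mem z hz =>
    obtain ⟨a, -, b, -, rfl⟩ := hz
    rw [← mul_assoc, bivector_mul_ι hω, mul_assoc, bivector_mul_ι hω, mul_assoc]
  | zero => simp
  | add x y _ _ hx hy => rw [add_mul, mul_add, hx, hy]
  | smul c x _ hx => rw [smul_mul_assoc, mul_smul_comm, hx]

lemma contract_bivector_mul {ω : ExteriorAlgebra ℂ W} (hω : ω ∈ wedgeSq (⊤ : Submodule ℂ W))
    (f : Module.Dual ℂ W) (z : ExteriorAlgebra ℂ W) :
    contract f (ω * z) = contract f ω * z + ω * contract f z := by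
  induction hω using Submodule.span_induction with
  | mem z hz =>
    obtain ⟨a, -, b, -, rfl⟩ := hz
    rw [mul_assoc, contract_ι_mul, contract_ι_mul, contract_ι_mul_ι]
    simp only [map_sub, map_smul, sub_mul, mul_sub, smul_mul_assoc, mul_smul_comm, mul_assoc]
    abel
  | zero => simp
  | add x y _ _ hx hy => simp only [add_mul, map_add, hx, hy]; abel
  | smul c x _ hx => simp only [smul_mul_assoc, map_smul, hx, smul_add]

lemma sum_ι_mul_contract [FiniteDimensional ℂ W] {ω : ExteriorAlgebra ℂ W}
    (hω : ω ∈ wedgeSq (⊤ : Submodule ℂ W)) :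
    ∑ i, ι ℂ (Module.finBasis ℂ W i) * contract ((Module.finBasis ℂ W).coord i) ω =
      (2 : ℂ) • ω := by
  have key (a b : W) :
      ∑ i, ((Module.finBasis ℂ W).coord i a) • (ι ℂ (Module.finBasis ℂ W i) * ι ℂ b) =
        ι ℂ a * ι ℂ b := by
    conv_rhs => rw [← (Module.finBasis ℂ W).sum_repr a]
    simp only [map_sum, map_smul, Finset.sum_mul, smul_mul_assoc, Module.Basis.coord_apply]
  induction hω using Submodule.span_induction with
  | mem z hz =>
    obtain ⟨a, -, b, -, rfl⟩ := hz
    simp only [contract_ι_mul_ι, map_sub, map_smul, mul_sub, mul_smul_comm,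
      Finset.sum_sub_distrib, key]
    rw [ι_mul_ι_swap b a, two_smul, sub_neg_eq_add]
  | zero => simp
  | add x y _ _ hx hy => simp only [map_add, mul_add, Finset.sum_add_distrib, hx, hy, smul_add]
  | smul c x _ hx => simp only [map_smul, mul_smul_comm, ← Finset.smul_sum, hx, smul_comm c]

lemma exists_eq_ι_mul_ι_of_ι_mul_eq_zero {ω : ExteriorAlgebra ℂ W}
    (hω : ω ∈ wedgeSq (⊤ : Submodule ℂ W)) {w : W} (hw : w ≠ 0) (h : ι ℂ w * ω = 0) :
    ∃ x, ω = ι ℂ w * ι ℂ x := by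
  obtain ⟨g, hg, -⟩ := exists_dual_eq_one_of_notMem (p := ⊥) (x := w) (by simpa using hw)
  obtain ⟨x, hx⟩ := exists_contract_eq_ι hω g
  refine ⟨x, ?_⟩
  have := congrArg (contract g) h
  rw [contract_ι_mul, hg, hx, one_smul, map_zero] at this
  exact sub_eq_zero.1 this

/-- A bivector with zero square is decomposable. -/
lemma exists_eq_ι_mul_ι_of_mul_self_eq_zero [FiniteDimensional ℂ W] {ω : ExteriorAlgebra ℂ W}
    (hω : ω ∈ wedgeSq (⊤ : Submodule ℂ W)) (h : ω * ω = 0) : ∃ a b, ω = ι ℂ a * ι ℂ b := by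
  by_cases h0 : ω = 0
  · exact ⟨0, 0, by simp [h0]⟩
  obtain ⟨f, hf⟩ : ∃ f, contract f ω ≠ 0 := by
    by_contra! hall
    have := sum_ι_mul_contract hω
    simp only [hall, mul_zero, Finset.sum_const_zero] at this
    exact h0 (by simpa using this.symm)
  obtain ⟨w, hw⟩ := exists_contract_eq_ι hω f
  refine ⟨w, exists_eq_ι_mul_ι_of_ι_mul_eq_zero hω (fun hw0 => hf (by simp [hw, hw0])) ?_⟩
  have := congrArg (contract f) h
  rw [contract_bivector_mul hω, hw, bivector_mul_ι hω, map_zero, ← two_smul ℂ] at this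
  simpa using this

lemma notMem_span_singleton_of_ι_mul_ι_ne_zero {a b : W} (h : ι ℂ a * ι ℂ b ≠ 0) :
    a ∉ Submodule.span ℂ {b} := by
  rw [Submodule.mem_span_singleton]
  rintro ⟨c, rfl⟩
  simp at h

lemma exists_eq_add_of_mul_eq_zero {ω : ExteriorAlgebra ℂ W}
    (hω : ω ∈ wedgeSq (⊤ : Submodule ℂ W)) {a b : W} (hab : ι ℂ a * ι ℂ b ≠ 0)
    (h : ι ℂ a * ι ℂ b * ω = 0) : ∃ x y, ω = ι ℂ a * ι ℂ x + ι ℂ b * ι ℂ y := by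
  obtain ⟨f, hfa, hfb⟩ :=
    exists_dual_eq_one_of_notMem (notMem_span_singleton_of_ι_mul_ι_ne_zero hab)
  obtain ⟨x, hx⟩ := exists_contract_eq_ι hω f
  have hb : b ≠ 0 := fun hb => hab (by simp [hb])
  have h1 : ι ℂ b * (ω - ι ℂ a * ι ℂ x) = 0 := by
    have := congrArg (contract f) h
    rw [mul_assoc, contract_ι_mul, contract_ι_mul, hfa, hfb b (Submodule.mem_span_singleton_self b),
      hx, map_zero, one_smul, zero_smul, zero_sub, mul_neg, ← mul_assoc, ι_mul_ι_swap a b] at this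
    simpa [mul_sub, mul_add, mul_assoc, sub_eq_add_neg] using this
  obtain ⟨y, hy⟩ := exists_eq_ι_mul_ι_of_ι_mul_eq_zero
    (Submodule.sub_mem _ hω (ι_mul_mem_wedgeSq trivial trivial)) hb h1
  exact ⟨x, y, by rw [← hy]; abel⟩

lemma mem_wedgeSq_of_mul_eq_zero {ω : ExteriorAlgebra ℂ W}
    (hω : ω ∈ wedgeSq (⊤ : Submodule ℂ W)) {a b c d : W}
    (hne : ι ℂ a * ι ℂ b * (ι ℂ c * ι ℂ d) ≠ 0) (hab : ι ℂ a * ι ℂ b * ω = 0)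
    (hcd : ι ℂ c * ι ℂ d * ω = 0) :
    ω ∈ wedgeSq (Submodule.span ℂ {a, b, c, d}) := by
  obtain ⟨x, y, rfl⟩ := exists_eq_add_of_mul_eq_zero hω (fun h => hne (by rw [h, zero_mul])) hab
  have key (f : Module.Dual ℂ W) (hf : ∀ v ∈ Submodule.span ℂ {a, b, c, d}, f v = 0) :
      f x = 0 ∧ f y = 0 := by
    have ha := hf a (Submodule.subset_span (by simp))
    have hb := hf b (Submodule.subset_span (by simp))
    have hc := hf c (Submodule.subset_span (by simp))
    have hd := hf d (Submodule.subset_span (by simp))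
    have h1 : ι ℂ c * ι ℂ d * (f x • ι ℂ a + f y • ι ℂ b) = 0 := by
      have := congrArg (contract f) hcd
      rw [mul_assoc, contract_ι_mul, contract_ι_mul, map_add, contract_ι_mul_ι, contract_ι_mul_ι,
        ha, hb, hc, hd, map_zero] at this
      rw [← neg_eq_zero, ← this]
      simp only [zero_smul, zero_sub, map_neg, map_smul, mul_neg, mul_add, mul_assoc, neg_neg,
        mul_smul_comm]
      abel
    rw [bivector_mul_comm (ι_mul_mem_wedgeSq trivial trivial)
      (ι_mul_mem_wedgeSq trivial trivial)] at hne
    constructor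
    · have := congrArg (· * ι ℂ b) h1
      simp only [mul_assoc, add_mul, smul_mul_assoc, ι_sq_zero, smul_zero, add_zero, zero_mul,
        mul_smul_comm] at this hne
      exact (smul_eq_zero.1 this).resolve_right hne
    · have := congrArg (· * ι ℂ a) h1
      rw [ι_mul_ι_swap a b] at hne
      simp only [mul_assoc, add_mul, smul_mul_assoc, ι_sq_zero, smul_zero, zero_add, zero_mul,
        mul_smul_comm, mul_neg, ne_eq, neg_eq_zero] at this hne
      exact (smul_eq_zero.1 this).resolve_right hne
  refine Submodule.add_mem _
    (ι_mul_mem_wedgeSq (Submodule.subset_span (by simp)) ?_)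
    (ι_mul_mem_wedgeSq (Submodule.subset_span (by simp)) ?_)
  · exact mem_of_forall_dual_eq_zero fun f hf => (key f hf).1
  · exact mem_of_forall_dual_eq_zero fun f hf => (key f hf).2

lemma ι_mul_ι_mul_ne_zero {a b c y : W}
    (habc : ι ℂ a * ι ℂ b * ι ℂ c ≠ 0) (hy : y ∉ Submodule.span ℂ {a, b, c}) :
    ι ℂ y * (ι ℂ a * ι ℂ b * ι ℂ c) ≠ 0 := by
  obtain ⟨f, hfy, hf⟩ := exists_dual_eq_one_of_notMem hy
  have ha := hf a (Submodule.subset_span (by simp))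
  have hb := hf b (Submodule.subset_span (by simp))
  have hc := hf c (Submodule.subset_span (by simp))
  intro h
  have := congrArg (contract f) h
  rw [contract_ι_mul, mul_assoc, contract_ι_mul, contract_ι_mul_ι, hfy, ha, hb, hc] at this
  exact habc (by simpa [mul_assoc] using this)

lemma finrank_span_four_le (a b c d : W) :
    Module.finrank ℂ (Submodule.span ℂ {a, b, c, d}) ≤ 4 := by
  classical
  have := finrank_span_finset_le_card (R := ℂ) ({a, b, c, d} : Finset W)
  simp only [Finset.coe_insert, Finset.coe_singleton] at this
  exact this.trans Finset.card_le_four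

lemma exists_wedgeSq_of_mul_eq_zero {ω η : ExteriorAlgebra ℂ W}
    (hω : ω ∈ wedgeSq (⊤ : Submodule ℂ W)) {a b c : W}
    (habc : ι ℂ a * ι ℂ b * ι ℂ c ≠ 0) (hab : ι ℂ a * ι ℂ b * ω = 0)
    (hac : ι ℂ a * ι ℂ c * ω ∈ Submodule.span ℂ {η}) (hsq : ω * ω ∈ Submodule.span ℂ {η}) :
    ∃ p : Submodule ℂ W, Module.finrank ℂ p ≤ 4 ∧ ι ℂ a * ι ℂ b ∈ wedgeSq p ∧
      ι ℂ a * ι ℂ c ∈ wedgeSq p ∧ ω ∈ wedgeSq p := by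
  obtain ⟨x, y, rfl⟩ := exists_eq_add_of_mul_eq_zero hω (fun h => habc (by rw [h, zero_mul])) hab
  by_cases hy : y ∈ Submodule.span ℂ {a, b, c}
  · have hle : Submodule.span ℂ {a, b, c} ≤ Submodule.span ℂ {a, b, c, x} :=
      Submodule.span_mono (by intro z; simp; tauto)
    have ha : a ∈ Submodule.span ℂ {a, b, c, x} := Submodule.subset_span (by simp)
    have hb : b ∈ Submodule.span ℂ {a, b, c, x} := Submodule.subset_span (by simp)
    have hc : c ∈ Submodule.span ℂ {a, b, c, x} := Submodule.subset_span (by simp)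
    have hx : x ∈ Submodule.span ℂ {a, b, c, x} := Submodule.subset_span (by simp)
    exact ⟨_, finrank_span_four_le a b c x, ι_mul_mem_wedgeSq ha hb, ι_mul_mem_wedgeSq ha hc,
      Submodule.add_mem _ (ι_mul_mem_wedgeSq ha hx) (ι_mul_mem_wedgeSq hb (hle hy))⟩
  · have hne := ι_mul_ι_mul_ne_zero habc hy
    have ha : a ∈ Submodule.span ℂ {a, b, c, y} := Submodule.subset_span (by simp)
    have hb : b ∈ Submodule.span ℂ {a, b, c, y} := Submodule.subset_span (by simp)
    have hc : c ∈ Submodule.span ℂ {a, b, c, y} := Submodule.subset_span (by simp)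
    have hy' : y ∈ Submodule.span ℂ {a, b, c, y} := Submodule.subset_span (by simp)
    have hac' : ι ℂ a * ι ℂ c * (ι ℂ a * ι ℂ x + ι ℂ b * ι ℂ y) =
        ι ℂ y * (ι ℂ a * ι ℂ b * ι ℂ c) := by
      have h1 : ι ℂ a * ι ℂ c * (ι ℂ a * ι ℂ x) = 0 := by
        rw [ι_mul_ι_swap a c, neg_mul, mul_assoc, ι_mul_ι_left, mul_zero, neg_zero]
      rw [mul_add, h1, zero_add, mul_assoc (ι ℂ a) (ι ℂ b), ι_mul_ι_swap b c, ι_mul_ι_swap b y, mul_neg,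
        mul_neg, mul_neg, ← mul_assoc, ← mul_assoc (ι ℂ a) (ι ℂ c) (ι ℂ b),
        ← mul_assoc (ι ℂ y),
        bivector_mul_ι (ι_mul_mem_wedgeSq trivial trivial)]
    have hsq' : (ι ℂ a * ι ℂ x + ι ℂ b * ι ℂ y) * (ι ℂ a * ι ℂ x + ι ℂ b * ι ℂ y) =
        (2 : ℂ) • (ι ℂ a * ι ℂ x * (ι ℂ b * ι ℂ y)) := by
      have hsq0 (u v : W) : ι ℂ u * ι ℂ v * (ι ℂ u * ι ℂ v) = 0 := by
        rw [← mul_assoc, bivector_mul_ι (ι_mul_mem_wedgeSq trivial trivial), ι_mul_ι_left,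
          zero_mul]
      rw [add_mul, mul_add, mul_add, hsq0, hsq0, two_smul, zero_add, add_zero,
        bivector_mul_comm (ι_mul_mem_wedgeSq (a := b) (b := y) trivial trivial)
          (ι_mul_mem_wedgeSq trivial trivial)]
    rw [hac', Submodule.mem_span_singleton] at hac
    rw [hsq', Submodule.mem_span_singleton] at hsq
    obtain ⟨s, hs⟩ := hac
    obtain ⟨t, ht⟩ := hsq
    have hs0 : s ≠ 0 := by rintro rfl; exact hne (by simpa using hs.symm)
    have hx : x ∈ Submodule.span ℂ {a, b, c, y} := by
      refine mem_of_forall_dual_eq_zero fun f hf => ?_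
      have hη : contract f η = 0 := by
        have := congrArg (contract f) hs
        rw [map_smul, contract_ι_mul, mul_assoc, contract_ι_mul, contract_ι_mul_ι, hf a ha, hf b hb,
          hf c hc, hf y hy'] at this
        simpa [hs0] using this
      have := congrArg (contract f) ht
      rw [map_smul, hη, smul_zero, map_smul, mul_assoc, contract_ι_mul, contract_ι_mul,
        contract_ι_mul_ι, hf a ha, hf b hb, hf y hy'] at this
      have h2 : f x • (ι ℂ a * (ι ℂ b * ι ℂ y)) = 0 := by simpa using this
      refine (smul_eq_zero.1 h2).resolve_right fun h => hne ?_
      rw [← mul_assoc, bivector_mul_ι (ι_mul_mem_wedgeSq trivial trivial)] at h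
      rw [← mul_assoc, h, zero_mul]
    exact ⟨_, finrank_span_four_le a b c y, ι_mul_mem_wedgeSq ha hb, ι_mul_mem_wedgeSq ha hc,
      Submodule.add_mem _ (ι_mul_mem_wedgeSq ha hx) (ι_mul_mem_wedgeSq hb hy')⟩

lemma ι_mul_ι_eq_mul_of_mul_eq_zero {a b c d : W} (hab : ι ℂ a * ι ℂ b ≠ 0)
    (hcd : ι ℂ c * ι ℂ d ≠ 0) (h : ι ℂ a * ι ℂ b * (ι ℂ c * ι ℂ d) = 0) :
    ∃ w x z, ι ℂ a * ι ℂ b = ι ℂ w * ι ℂ x ∧ ι ℂ c * ι ℂ d = ι ℂ w * ι ℂ z := by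
  have hdep : ¬ LinearIndependent ℂ ![a, b, c, d] := fun hli =>
    ιMulti_ne_zero hli (by simpa [ιMulti_apply, mul_assoc] using h)
  obtain ⟨g, hg, i, hi⟩ := Fintype.not_linearIndependent_iff.1 hdep
  simp only [Fin.sum_univ_four, Matrix.cons_val] at hg
  have hzero {s t : ℂ} {u v : W} (huv : ι ℂ u * ι ℂ v ≠ 0) (h0 : s • u + t • v = 0) :
      s = 0 ∧ t = 0 := by
    have h1 := congrArg (fun w => ι ℂ w * ι ℂ v) h0
    have h2 := congrArg (fun w => ι ℂ u * ι ℂ w) h0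
    simp only [map_add, map_smul, add_mul, mul_add, smul_mul_assoc, mul_smul_comm, ι_sq_zero,
      smul_zero, add_zero, zero_add, map_zero, zero_mul, mul_zero] at h1 h2
    exact ⟨(smul_eq_zero.1 h1).resolve_right huv, (smul_eq_zero.1 h2).resolve_right huv⟩
  have hmul (s t : ℂ) (u v : W) : ι ℂ (s • u + t • v) * (ι ℂ u * ι ℂ v) = 0 := by
    rw [map_add, add_mul, map_smul, map_smul, smul_mul_assoc, smul_mul_assoc, ι_mul_ι_left,
      ι_mul_ι_swap u v, mul_neg, ι_mul_ι_left]
    simp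
  have hw : g 0 • a + g 1 • b = (-g 2) • c + (-g 3) • d := by
    rw [← sub_eq_zero, ← hg]
    module
  have hw0 : g 0 • a + g 1 • b ≠ 0 := fun h0 => by
    have h1 := hzero hab h0
    have h2 := hzero hcd (hw ▸ h0)
    simp only [neg_eq_zero] at h2
    fin_cases i <;> simp_all
  obtain ⟨x, hx⟩ := exists_eq_ι_mul_ι_of_ι_mul_eq_zero (ω := ι ℂ a * ι ℂ b)
    (ι_mul_mem_wedgeSq trivial trivial) hw0 (hmul _ _ _ _)
  obtain ⟨z, hz⟩ := exists_eq_ι_mul_ι_of_ι_mul_eq_zero (ω := ι ℂ c * ι ℂ d)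
    (ι_mul_mem_wedgeSq trivial trivial) hw0 (hw ▸ hmul _ _ _ _)
  exact ⟨_, x, z, hx, hz⟩

lemma ι_mul_mul_ne_zero_of_linearIndependent {a b c : W}
    (h : LinearIndependent ℂ ![ι ℂ a * ι ℂ b, ι ℂ a * ι ℂ c]) : ι ℂ a * ι ℂ b * ι ℂ c ≠ 0 := by
  intro h0
  have ha : a ≠ 0 := by
    rintro rfl
    exact h.ne_zero 0 (by simp)
  have hac : ι ℂ a * ι ℂ c ≠ 0 := h.ne_zero 1
  have hli : ¬ LinearIndependent ℂ ![a, b, c] := fun hli =>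
    ιMulti_ne_zero hli (by simpa [ιMulti_apply, mul_assoc] using h0)
  obtain ⟨g, hg, i, hi⟩ := Fintype.not_linearIndependent_iff.1 hli
  simp only [Fin.sum_univ_three, Matrix.cons_val] at hg
  have h1 := congrArg (fun w => ι ℂ a * ι ℂ w) hg
  simp only [map_add, map_smul, mul_add, mul_smul_comm, ι_sq_zero, smul_zero, zero_add, map_zero,
    mul_zero] at h1
  obtain ⟨hg1, hg2⟩ := LinearIndependent.pair_iff.1 h _ _ h1
  have hg0 : g 0 = 0 := by simpa [hg1, hg2, ha] using hg
  fin_cases i <;> simp_all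

/-- Two decomposable bivectors and a third one whose products are all proportional lie in the
exterior square of a common subspace of dimension at most four. -/
lemma exists_wedgeSq_of_mul_mem_span [FiniteDimensional ℂ W] {u v ω η : ExteriorAlgebra ℂ W}
    (hu : u ∈ wedgeSq (⊤ : Submodule ℂ W)) (hv : v ∈ wedgeSq (⊤ : Submodule ℂ W))
    (hω : ω ∈ wedgeSq (⊤ : Submodule ℂ W)) (hli : LinearIndependent ℂ ![u, v])
    (huu : u * u = 0) (hvv : v * v = 0) (huv : u * v ∈ Submodule.span ℂ {η})
    (huω : u * ω ∈ Submodule.span ℂ {η}) (hvω : v * ω ∈ Submodule.span ℂ {η})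
    (hωω : ω * ω ∈ Submodule.span ℂ {η}) :
    ∃ p : Submodule ℂ W, Module.finrank ℂ p ≤ 4 ∧ u ∈ wedgeSq p ∧ v ∈ wedgeSq p ∧
      ω ∈ wedgeSq p := by
  obtain ⟨s, hs⟩ := Submodule.mem_span_singleton.1 huω
  obtain ⟨t, ht⟩ := Submodule.mem_span_singleton.1 hvω
  obtain ⟨r, hr⟩ := Submodule.mem_span_singleton.1 huv
  have hu0 : u ≠ 0 := hli.ne_zero 0
  have hv0 : v ≠ 0 := hli.ne_zero 1
  obtain ⟨a, b, hab⟩ := exists_eq_ι_mul_ι_of_mul_self_eq_zero hu huu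
  obtain ⟨c, d, hcd⟩ := exists_eq_ι_mul_ι_of_mul_self_eq_zero hv hvv
  by_cases h0 : u * v = 0
  · obtain ⟨w, x, z, hx, hz⟩ := ι_mul_ι_eq_mul_of_mul_eq_zero (hab ▸ hu0) (hcd ▸ hv0)
      (hab ▸ hcd ▸ h0)
    rw [← hab] at hx
    rw [← hcd] at hz
    by_cases hs0 : s = 0
    · have hne := ι_mul_mul_ne_zero_of_linearIndependent (hx ▸ hz ▸ hli)
      rw [hx, hz]
      refine exists_wedgeSq_of_mul_eq_zero hω hne ?_ (hz ▸ hvω) hωω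
      rw [← hx, ← hs, hs0, zero_smul]
    · have hv' : v - (t / s) • u = ι ℂ w * ι ℂ (z - (t / s) • x) := by
        rw [hx, hz, map_sub, map_smul, mul_sub, mul_smul_comm]
      have hli' : LinearIndependent ℂ ![v - (t / s) • u, u] := by
        rw [LinearIndependent.pair_iff] at hli ⊢
        intro α β h
        obtain ⟨h1, h2⟩ := hli (β - α * (t / s)) α (by rw [← h]; module)
        exact ⟨h2, by simpa [h2] using h1⟩
      have hne := ι_mul_mul_ne_zero_of_linearIndependent (hx ▸ hv' ▸ hli')
      obtain ⟨p, hp, h1, h2, h3⟩ := exists_wedgeSq_of_mul_eq_zero hω hne (by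
        rw [← hv', sub_mul, smul_mul_assoc, ← hs, ← ht, smul_smul, div_mul_cancel₀ _ hs0, sub_self])
        (hx ▸ huω) hωω
      rw [← hx] at h2
      rw [← hv'] at h1
      refine ⟨p, hp, h2, ?_, h3⟩
      simpa using add_mem h1 (Submodule.smul_mem _ (t / s) h2)
  · have hr0 : r ≠ 0 := by
      rintro rfl
      exact h0 (by simpa using hr.symm)
    set ω' := ω - (t / r) • u - (s / r) • v with hω'
    have h1 : u * ω' = 0 := by
      rw [hω', mul_sub, mul_sub, mul_smul_comm, mul_smul_comm, huu, ← hs, ← hr, smul_smul,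
        div_mul_cancel₀ _ hr0]
      simp
    have h2 : v * ω' = 0 := by
      rw [hω', mul_sub, mul_sub, mul_smul_comm, mul_smul_comm, hvv, ← ht, bivector_mul_comm hv hu,
        ← hr, smul_smul, div_mul_cancel₀ _ hr0]
      simp
    have hmem := mem_wedgeSq_of_mul_eq_zero
      (sub_mem (sub_mem hω (Submodule.smul_mem _ _ hu)) (Submodule.smul_mem _ _ hv))
      (hab ▸ hcd ▸ h0) (hab ▸ h1) (hcd ▸ h2)
    have hup : u ∈ wedgeSq (Submodule.span ℂ {a, b, c, d}) := by
      rw [hab]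
      exact ι_mul_mem_wedgeSq (Submodule.subset_span (by simp)) (Submodule.subset_span (by simp))
    have hvp : v ∈ wedgeSq (Submodule.span ℂ {a, b, c, d}) := by
      rw [hcd]
      exact ι_mul_mem_wedgeSq (Submodule.subset_span (by simp)) (Submodule.subset_span (by simp))
    refine ⟨_, finrank_span_four_le a b c d, hup, hvp, ?_⟩
    have := add_mem (add_mem hmem (Submodule.smul_mem _ (s / r) hvp))
      (Submodule.smul_mem _ (t / r) hup)
    simpa using this

/-- Two bivectors whose products are all proportional have a nontrivial linear combination with
zero square. -/
lemma exists_mul_self_eq_zero {u v η : ExteriorAlgebra ℂ W}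
    (hu : u ∈ wedgeSq (⊤ : Submodule ℂ W)) (hv : v ∈ wedgeSq (⊤ : Submodule ℂ W))
    (huu : u * u ∈ Submodule.span ℂ {η}) (huv : u * v ∈ Submodule.span ℂ {η})
    (hvv : v * v ∈ Submodule.span ℂ {η}) :
    ∃ s t : ℂ, (s ≠ 0 ∨ t ≠ 0) ∧ (s • u + t • v) * (s • u + t • v) = 0 := by
  obtain ⟨α, hα⟩ := Submodule.mem_span_singleton.1 huu
  obtain ⟨β, hβ⟩ := Submodule.mem_span_singleton.1 huv
  obtain ⟨γ, hγ⟩ := Submodule.mem_span_singleton.1 hvv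
  have key (s t : ℂ) : (s • u + t • v) * (s • u + t • v) =
      (α * (s * s) + 2 * β * s * t + γ * (t * t)) • η := by
    simp only [add_mul, mul_add, smul_mul_assoc, mul_smul_comm]
    rw [bivector_mul_comm hv hu, ← hα, ← hβ, ← hγ]
    module
  by_cases h : α = 0
  · exact ⟨1, 0, by simp, by rw [key, h]; simp⟩
  · obtain ⟨x, hx⟩ := exists_quadratic_eq_zero (b := 2 * β) (c := γ) h
      (IsAlgClosed.exists_eq_mul_self _)
    exact ⟨x, 1, by simp, by rw [key]; simp [← hx]⟩

lemma mul_mem_map_exteriorPower (p : Submodule ℂ W) {ω ω' : ExteriorAlgebra ℂ W}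
    (hω : ω ∈ wedgeSq p) (hω' : ω' ∈ wedgeSq p) :
    ω * ω' ∈ (⋀[ℂ]^4 p).map (ExteriorAlgebra.map p.subtype).toLinearMap := by
  have hle : wedgeSq p ≤ (⋀[ℂ]^2 p).map (ExteriorAlgebra.map p.subtype).toLinearMap := by
    refine Submodule.span_le.2 ?_
    rintro _ ⟨a, ha, b, hb, rfl⟩
    refine ⟨ι ℂ ⟨a, ha⟩ * ι ℂ ⟨b, hb⟩, ?_, by simp⟩
    rw [exteriorPower, pow_two]
    exact Submodule.mul_mem_mul ⟨_, rfl⟩ ⟨_, rfl⟩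
  obtain ⟨x, hx, rfl⟩ := hle hω
  obtain ⟨y, hy, rfl⟩ := hle hω'
  refine ⟨x * y, ?_, by simp⟩
  rw [exteriorPower, show 4 = 2 + 2 from rfl, pow_add]
  exact Submodule.mul_mem_mul hx hy

lemma span_mul_le_map_exteriorPower {p : Submodule ℂ W} {U : Submodule ℂ (ExteriorAlgebra ℂ W)}
    (hU : U ≤ wedgeSq p) :
    Submodule.span ℂ {z : ExteriorAlgebra ℂ W | ∃ ω ∈ U, ∃ ω' ∈ U, z = ω * ω'} ≤
      (⋀[ℂ]^4 p).map (ExteriorAlgebra.map p.subtype).toLinearMap := by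
  refine Submodule.span_le.2 ?_
  rintro _ ⟨ω, hω, ω', hω', rfl⟩
  exact mul_mem_map_exteriorPower p (hU hω) (hU hω')

end ExteriorAlgebra

lemma Submodule.exists_linearIndependent_vecCons {U : Submodule ℂ W} {k : ℕ} {v : Fin k → W}
    (hv : LinearIndependent ℂ v) (hk : k < Module.finrank ℂ U) :
    ∃ w ∈ U, LinearIndependent ℂ (Matrix.vecCons w v) := by
  obtain ⟨w, hwU, hw⟩ : ∃ w ∈ U, w ∉ Submodule.span ℂ (Set.range v) := by
    by_contra! h
    have := FiniteDimensional.span_of_finite ℂ (Set.finite_range v)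
    have := Submodule.finrank_mono (show U ≤ Submodule.span ℂ (Set.range v) from h)
    rw [finrank_span_eq_card hv, Fintype.card_fin] at this
    omega
  exact ⟨w, hwU, linearIndependent_finCons.2 ⟨hv, hw⟩⟩

lemma Submodule.exists_le_finrank_eq [FiniteDimensional ℂ W] {p : Submodule ℂ W} {k : ℕ}
    (hp : Module.finrank ℂ p ≤ k) (hk : k ≤ Module.finrank ℂ W) :
    ∃ q : Submodule ℂ W, p ≤ q ∧ Module.finrank ℂ q = k := by
  induction k, hp using Nat.le_induction with
  | base => exact ⟨p, le_rfl, rfl⟩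
  | succ k _ ih =>
    obtain ⟨q, hpq, hq⟩ := ih (by omega)
    obtain ⟨x, hx⟩ : ∃ x, x ∉ q := by
      by_contra! h
      rw [(Submodule.eq_top_iff'.2 h : q = ⊤), finrank_top] at hq
      omega
    refine ⟨q ⊔ Submodule.span ℂ {x}, hpq.trans le_sup_left, ?_⟩
    rw [Submodule.finrank_sup_span_singleton hx, hq]

end

/-- for `n ≥ 3`, `dim W = n+1` and a 3-dimensional subspace `U ⊆ Λ²W`, the span
of `{ω ∧ ω' : ω, ω' ∈ U}` in `Λ⁴W` has dimension at most 1 iff there exists a 4-dimensional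
subspace `W₄ ⊆ W` with `U ⊆ Λ²W₄`. -/
theorem stmt8 {W : Type*} [AddCommGroup W] [Module ℂ W] [FiniteDimensional ℂ W]
    (n : ℕ) (hn : 3 ≤ n) (hdimW : Module.finrank ℂ W = n + 1)
    (U : Submodule ℂ (ExteriorAlgebra ℂ W))
    (hU : U ≤ wedgeSq (⊤ : Submodule ℂ W))
    (hdim : Module.finrank ℂ U = 3) :
    Module.finrank ℂ
        (Submodule.span ℂ {z : ExteriorAlgebra ℂ W | ∃ ω ∈ U, ∃ ω' ∈ U, z = ω * ω'}) ≤ 1 ↔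
      ∃ W₄ : Submodule ℂ W, Module.finrank ℂ W₄ = 4 ∧ U ≤ wedgeSq W₄ := by
  constructor
  · intro h
    have hmul {x y : ExteriorAlgebra ℂ W} (hx : x ∈ U) (hy : y ∈ U) :
        x * y ∈ Submodule.span ℂ
          {z : ExteriorAlgebra ℂ W | ∃ ω ∈ U, ∃ ω' ∈ U, z = ω * ω'} :=
      Submodule.subset_span ⟨x, hx, y, hy, rfl⟩
    have hfin := Submodule.finiteDimensional_of_le (span_mul_le_map_exteriorPower hU)
    obtain ⟨η, hη⟩ := finrank_le_one_iff.1 h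
    replace hmul {x y : ExteriorAlgebra ℂ W} (hx : x ∈ U) (hy : y ∈ U) :
        x * y ∈ Submodule.span ℂ {(η : ExteriorAlgebra ℂ W)} := by
      obtain ⟨c, hc⟩ := hη ⟨_, hmul hx hy⟩
      exact Submodule.mem_span_singleton.2 ⟨c, congrArg Subtype.val hc⟩
    obtain ⟨v, hv, hliv⟩ := U.exists_linearIndependent_vecCons
      (linearIndependent_empty_type (v := (![] : Fin 0 → ExteriorAlgebra ℂ W))) (by omega)
    obtain ⟨v', hv', hliv'⟩ := U.exists_linearIndependent_vecCons hliv (by omega)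
    obtain ⟨s, t, hst, hsq⟩ := exists_mul_self_eq_zero (hU hv') (hU hv) (hmul hv' hv')
      (hmul hv' hv) (hmul hv hv)
    have huU := add_mem (U.smul_mem s hv') (U.smul_mem t hv)
    have hu0 : s • v' + t • v ≠ 0 := fun h0 => by
      have := LinearIndependent.pair_iff.1 hliv' s t h0
      tauto
    generalize s • v' + t • v = u at hsq huU hu0
    obtain ⟨w, hw, hliw⟩ := U.exists_linearIndependent_vecCons
      (v := ![u]) (LinearIndependent.of_subsingleton 0 hu0) (by omega)
    obtain ⟨w', hw', hliw'⟩ := U.exists_linearIndependent_vecCons hliw (by omega)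
    obtain ⟨s, t, hst, hsq'⟩ := exists_mul_self_eq_zero (hU hw') (hU hw) (hmul hw' hw')
      (hmul hw' hw) (hmul hw hw)
    have huU' := add_mem (U.smul_mem s hw') (U.smul_mem t hw)
    have hli : LinearIndependent ℂ ![s • w' + t • w, u] := by
      rw [LinearIndependent.pair_iff]
      intro α β h0
      have := Fintype.linearIndependent_iff.1 hliw' ![α * s, α * t, β] (by
        simp only [Fin.sum_univ_three, Matrix.cons_val]
        rw [← h0]
        module)
      have h1 := this 0
      have h2 := this 1
      have h3 := this 2
      simp only [Matrix.cons_val, mul_eq_zero] at h1 h2 h3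
      tauto
    generalize s • w' + t • w = u' at hsq' huU' hli
    obtain ⟨ω, hω, hliω⟩ := U.exists_linearIndependent_vecCons hli (by omega)
    obtain ⟨p, hp, hp1, hp2, hp3⟩ := exists_wedgeSq_of_mul_mem_span (hU huU') (hU huU) (hU hω) hli
      hsq' hsq (hmul huU' huU) (hmul huU' hω) (hmul huU hω) (hmul hω hω)
    obtain ⟨q, hpq, hq⟩ := Submodule.exists_le_finrank_eq hp (by omega)
    refine ⟨q, hq, le_trans ?_ (wedgeSq_mono hpq)⟩
    have hspan : Submodule.span ℂ (Set.range ![ω, u', u]) = U := by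
      have : FiniteDimensional ℂ U := Module.finite_of_finrank_pos (by omega)
      refine Submodule.eq_of_le_of_finrank_eq (Submodule.span_le.2 ?_) ?_
      · rintro _ ⟨i, rfl⟩
        fin_cases i <;> assumption
      · rw [finrank_span_eq_card hliω, hdim, Fintype.card_fin]
    rw [← hspan, Submodule.span_le]
    rintro _ ⟨i, rfl⟩
    fin_cases i <;> assumption
  · rintro ⟨p, hp, hUp⟩
    refine (Submodule.finrank_mono (span_mul_le_map_exteriorPower hUp)).trans
      ((Submodule.finrank_map_le _ _).trans ?_)
    rw [exteriorPower.finrank_eq, hp, Nat.choose_self]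
end
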